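/- arXiv:0803.0573 — 3 statements merged into one kernel-verified Lean document; each statement's English description precedes it below -/
import Mathlib

section
/- Let A be a commutative ring and let f, g ∈ A be a regular sequence. In the polynomial ring A[x,y], the ideal generated by the set of elements a·x + b·y, where (a,b) ranges over all pairs in A² with a·f + b·g = 0, is equal to the principal ideal generated by L := y·f − x·g; moreover L = y·f − x·g is a nonzerodivisor in A[x,y]. -/
open MvPolynomial

/-- If `f` is a nonzerodivisor of `A`, then `y·f − x·g` is a nonzerodivisor of `A[x,y]`. -/
theorem MvPolynomial.eq_zero_of_mul_X_one_sub_X_zero_eq_zero {A : Type*} [CommRing A]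
    {f : A} (g : A) (hf : ∀ a : A, a * f = 0 → a = 0) {p : MvPolynomial (Fin 2) A}
    (hp : p * (X 1 * C f - X 0 * C g) = 0) : p = 0 := by
  have hL : p * (X 1 * C f - X 0 * C g) = C f * (p * X 1) - C g * (p * X 0) := by ring
  have key : ∀ (n : ℕ) (m : Fin 2 →₀ ℕ), m 0 = n → coeff m p = 0 := by
    intro n
    induction n with
    | zero =>
      intro m hm
      have h := congrArg (coeff (m + Finsupp.single 1 1)) hp
      rw [hL, coeff_sub, coeff_C_mul, coeff_C_mul, coeff_mul_X,
        coeff_mul_X', if_neg (by simp [hm])] at h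
      exact hf _ (by simpa [mul_comm] using h)
    | succ n ih =>
      intro m hm
      have h := congrArg (coeff (m + Finsupp.single 1 1)) hp
      rw [hL, coeff_sub, coeff_C_mul, coeff_C_mul, coeff_mul_X,
        coeff_mul_X', if_pos (by simp [hm]), ih (_ - _) (by simp [hm])] at h
      exact hf _ (by simpa [mul_comm] using h)
  ext m
  simpa using key _ m rfl

/-- Let `A` be a commutative ring and `f, g ∈ A` a regular sequence.
In `A[x,y]` (realized as `MvPolynomial (Fin 2) A` with `x = X 0`, `y = X 1`), the ideal
generated by the elements `a·x + b·y`, for `(a,b)` ranging over the syzygies of `(f,g)`,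
equals the principal ideal generated by `L = y·f − x·g`; moreover `L` is a
nonzerodivisor in `A[x,y]`. -/
theorem stmt1 {A : Type*} [CommRing A] (f g : A)
    (hf : ∀ a : A, a * f = 0 → a = 0)
    (hg : ∀ a : A, a * g ∈ Ideal.span ({f} : Set A) → a ∈ Ideal.span ({f} : Set A))
    (hproper : Ideal.span ({f, g} : Set A) ≠ ⊤) :
    Ideal.span {p : MvPolynomial (Fin 2) A |
        ∃ a b : A, a * f + b * g = 0 ∧ p = C a * X 0 + C b * X 1} =
      Ideal.span ({X 1 * C f - X 0 * C g} : Set (MvPolynomial (Fin 2) A)) ∧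
    (∀ p : MvPolynomial (Fin 2) A, p * (X 1 * C f - X 0 * C g) = 0 → p = 0) := by
  refine ⟨le_antisymm ?_ ?_, fun p hp => eq_zero_of_mul_X_one_sub_X_zero_eq_zero g hf hp⟩
  · rw [Ideal.span_le]
    rintro _ ⟨a, b, hab, rfl⟩
    obtain ⟨c, rfl⟩ := Ideal.mem_span_singleton'.mp
      (hg b (Ideal.mem_span_singleton'.mpr ⟨-a, by linear_combination -hab⟩))
    obtain rfl : a = -(c * g) :=
      eq_neg_of_add_eq_zero_left (hf _ (by linear_combination hab))
    refine Ideal.mem_span_singleton'.mpr ⟨C c, ?_⟩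
    simp only [map_neg, map_mul]
    ring
  · rw [Ideal.span_singleton_le_iff_mem]
    refine Ideal.subset_span ⟨-g, f, by ring, ?_⟩
    simp only [map_neg]
    ring
end

section
/- Let k be a field, A = k[t_0,…,t_n], and for i = 0,…,n let f_i, g_i ∈ A be nonzero homogeneous polynomials of degree d_i ≥ 1. Set R = A[x_0,y_0,…,x_n,y_n] and L_i = x_i·g_i − y_i·f_i ∈ R, and I^{(i)} = (f_i,g_i) ⊆ A. Then the following are equivalent: (1) L_0,…,L_n is a regular sequence in R; (2) for every r ∈ {1,…,n+1}, the height (Krull codimension) in A of the ideal Σ_{α ⊆ {0,…,n}, |α| = r} ∏_{i∈α} I^{(i)} is at least n + 2 − r. -/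
open MvPolynomial

/-- A finite family `L : ι → R` (with `ι` linearly ordered) is a regular sequence:
each `L j` is a nonzerodivisor modulo the ideal generated by the previous ones, and
the ideal generated by all of them is proper. -/
def IsRegularSeq {R : Type*} [CommRing R] {ι : Type*} [LinearOrder ι] (L : ι → R) : Prop :=
  (∀ j : ι, ∀ p : R,
      p * L j ∈ Ideal.span (L '' {i : ι | i < j}) → p ∈ Ideal.span (L '' {i : ι | i < j})) ∧
    Ideal.span (Set.range L) ≠ ⊤

/-- The height of an ideal `J`: the infimum of the heights (in the prime spectrum)
of the prime ideals containing `J`. -/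
noncomputable def idealHeight {A : Type*} [CommRing A] (J : Ideal A) : ℕ∞ :=
  ⨅ p ∈ {p : PrimeSpectrum A | J ≤ p.asIdeal}, Order.height p

section

open IsLocalRing RingTheory.Sequence

theorem spanFinrank_maximalIdeal_quotient_add_one_le {R : Type*} [CommRing R] [IsLocalRing R]
    [IsNoetherianRing R] {x : R} (hx : x ∈ maximalIdeal R) (hx2 : x ∉ maximalIdeal R ^ 2)
    [IsLocalRing (R ⧸ Ideal.span {x})] :
    (maximalIdeal (R ⧸ Ideal.span {x})).spanFinrank + 1 ≤ (maximalIdeal R).spanFinrank := by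
  classical
  have hfg : Submodule.FG (maximalIdeal R) := IsNoetherian.noetherian _
  set s : Finset R := hfg.finite_generators.toFinset with hs
  have hcard : s.card = (maximalIdeal R).spanFinrank := by
    rw [← hfg.generators_ncard, Set.ncard_eq_toFinset_card _ hfg.finite_generators]
  have hspan : Ideal.span (s : Set R) = maximalIdeal R := by
    rw [hs, Set.Finite.coe_toFinset]
    exact Submodule.span_generators _
  rw [← hspan, ← Ideal.submodule_span_eq, Submodule.mem_span_finset] at hx
  obtain ⟨c, -, hc⟩ := hx
  obtain ⟨y, hys, hcy⟩ : ∃ y ∈ s, c y ∉ maximalIdeal R := by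
    by_contra! h
    refine hx2 (hc ▸ Ideal.sum_mem _ fun y hy ↦ ?_)
    rw [smul_eq_mul, pow_two]
    exact Ideal.mul_mem_mul (h y hy) (hspan ▸ Ideal.subset_span hy)
  have hunit : IsUnit (c y) := by simpa using hcy
  set φ := Ideal.Quotient.mk (Ideal.span {x})
  have hmap : maximalIdeal (R ⧸ Ideal.span {x}) = Ideal.span ((s.erase y).image φ : Set _) := by
    rw [← IsLocalRing.map_maximalIdeal_of_surjective φ Ideal.Quotient.mk_surjective, ← hspan,
      Ideal.map_span]
    apply le_antisymm
    · rw [Ideal.span_le]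
      rintro _ ⟨z, hz, rfl⟩
      by_cases hzy : z = y
      · subst hzy
        have h0 : ∑ a ∈ s, φ (c a) * φ a = 0 := by
          simp only [← map_mul, ← map_sum]
          exact Ideal.Quotient.eq_zero_iff_mem.mpr
            (by simp [← hc])
        rw [← Finset.add_sum_erase _ _ hys] at h0
        rw [SetLike.mem_coe, ← Ideal.unit_mul_mem_iff_mem _ (hunit.map φ),
          eq_neg_of_add_eq_zero_left h0]
        refine neg_mem (Ideal.sum_mem _ fun a ha ↦ Ideal.mul_mem_left _ _ ?_)
        exact Ideal.subset_span (Finset.mem_coe.mpr (Finset.mem_image_of_mem φ ha))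
      · exact Ideal.subset_span
          (Finset.mem_coe.mpr (Finset.mem_image_of_mem φ (Finset.mem_erase.mpr ⟨hzy, hz⟩)))
    · exact Ideal.span_mono (by
        rw [Finset.coe_image]
        exact Set.image_mono (Finset.coe_subset.mpr (Finset.erase_subset _ _)))
  rw [hmap, ← hcard, ← Finset.card_erase_add_one hys]
  gcongr
  refine (Submodule.spanFinrank_span_le_ncard_of_finite (Finset.finite_toSet _)).trans ?_
  rw [Set.ncard_coe_finset]
  exact Finset.card_image_le

theorem IsRegularLocalRing.quotient_span_singleton {R : Type*} [CommRing R] [IsRegularLocalRing R]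
    {x : R} (hx : x ∈ maximalIdeal R) (hx2 : x ∉ maximalIdeal R ^ 2) :
    IsRegularLocalRing (R ⧸ Ideal.span {x}) := by
  have hne : Nontrivial (R ⧸ Ideal.span {x}) := Ideal.Quotient.nontrivial_iff.mpr
    fun h ↦ (mem_maximalIdeal x).mp hx (Ideal.span_singleton_eq_top.mp h)
  have : IsLocalRing (R ⧸ Ideal.span {x}) :=
    .of_surjective' (Ideal.Quotient.mk _) Ideal.Quotient.mk_surjective
  refine .of_spanFinrank_maximalIdeal_le _ ?_
  have h1 := spanFinrank_maximalIdeal_quotient_add_one_le hx hx2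
  have h2 := ringKrullDim_le_ringKrullDim_quotient_add_card {x}
    (by simpa [IsLocalRing.ringJacobson_eq_maximalIdeal] using hx)
  rw [← IsRegularLocalRing.spanFinrank_maximalIdeal, Finset.coe_singleton,
    Finset.card_singleton] at h2
  refine ENat.WithBot.add_le_add_one_right_iff.mp ?_
  exact le_trans (by exact_mod_cast h1) h2

theorem IsRegularLocalRing.exists_mem_maximalIdeal {R : Type*} [CommRing R] [IsRegularLocalRing R]
    (h : (maximalIdeal R).spanFinrank ≠ 0) :
    ∃ x ∈ maximalIdeal R, x ∉ maximalIdeal R ^ 2 ∧ ∀ p ∈ minimalPrimes R, x ∉ p := by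
  by_contra! H
  have hsub : (maximalIdeal R : Set R) ⊆
      ⋃ I ∈ insert (maximalIdeal R ^ 2) (minimalPrimes R), ((id I : Ideal R) : Set R) := by
    intro x hx
    simp only [Set.mem_iUnion]
    by_cases h2 : x ∈ maximalIdeal R ^ 2
    · exact ⟨_, Set.mem_insert _ _, h2⟩
    · obtain ⟨p, hp, hxp⟩ := H x hx h2
      exact ⟨p, Set.mem_insert_of_mem _ hp, hxp⟩
  obtain ⟨I, hI | hI, hle⟩ := (Ideal.subset_union_prime_finite
    ((minimalPrimes.finite_of_isNoetherianRing R).insert _) (maximalIdeal R ^ 2)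
    (maximalIdeal R ^ 2)
    (fun i hi hne _ ↦ ((Set.mem_insert_iff.mp hi).resolve_left hne).1.1)).mp hsub
  · subst hI
    refine h ?_
    rw [Submodule.eq_bot_of_le_smul_of_le_jacobson_bot (maximalIdeal R) (maximalIdeal R)
      (IsNoetherian.noetherian _) (by simpa [pow_two] using hle)
      (IsLocalRing.jacobson_eq_maximalIdeal ⊥ bot_ne_top).ge]
    exact Submodule.spanFinrank_bot
  · have hIp : I.IsPrime := hI.1.1
    have hm : maximalIdeal R = I := le_antisymm hle (le_maximalIdeal hIp.ne_top)
    have h0 : (maximalIdeal R).height = 0 := Ideal.height_eq_zero_iff.mpr (hm ▸ hI)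
    have := IsRegularLocalRing.spanFinrank_maximalIdeal (R := R)
    rw [← maximalIdeal_height_eq_ringKrullDim, h0] at this
    exact h (by exact_mod_cast this)

theorem IsRegularLocalRing.isDomain (R : Type*) [CommRing R] [IsRegularLocalRing R] :
    IsDomain R := by
  generalize hn : (maximalIdeal R).spanFinrank = n
  induction n using Nat.strong_induction_on generalizing R with
  | _ n ih =>
  by_cases h : (maximalIdeal R).spanFinrank = 0
  · rw [Submodule.spanFinrank_eq_zero_iff_eq_bot (IsNoetherian.noetherian _)] at h
    exact (isField_iff_maximalIdeal_eq.mpr h).isDomain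
  · obtain ⟨x, hx, hx2, hxp⟩ := exists_mem_maximalIdeal h
    have := quotient_span_singleton hx hx2
    have hdom := ih _ (hn ▸ spanFinrank_maximalIdeal_quotient_add_one_le hx hx2) _ rfl
    have hprime : (Ideal.span {x}).IsPrime := (Ideal.Quotient.isDomain_iff_prime _).mp hdom
    obtain ⟨p, hp, hpx⟩ := Ideal.exists_minimalPrimes_le (bot_le (a := Ideal.span {x}))
    have hpp : p.IsPrime := hp.1.1
    have hbot : p = ⊥ := by
      refine Submodule.eq_bot_of_le_smul_of_le_jacobson_bot (maximalIdeal R) p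
        (IsNoetherian.noetherian _) (fun y hy ↦ ?_)
        (IsLocalRing.jacobson_eq_maximalIdeal ⊥ bot_ne_top).ge
      obtain ⟨z, rfl⟩ := Ideal.mem_span_singleton.mp (hpx hy)
      exact Submodule.smul_mem_smul hx ((hpp.mem_or_mem hy).resolve_left (hxp p hp))
    have : (⊥ : Ideal R).IsPrime := hbot ▸ hpp
    exact IsDomain.of_bot_isPrime R

theorem IsRegularLocalRing.exists_isRegular (R : Type*) [CommRing R] [IsRegularLocalRing R] :
    ∃ rs : List R, rs.length = (maximalIdeal R).spanFinrank ∧ (∀ r ∈ rs, r ∈ maximalIdeal R) ∧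
      IsRegular R rs := by
  generalize hn : (maximalIdeal R).spanFinrank = n
  induction n generalizing R with
  | zero => exact ⟨[], rfl, by simp, .nil _ _⟩
  | succ n ih =>
    obtain ⟨x, hx, hx2, -⟩ := exists_mem_maximalIdeal (R := R) (by omega)
    have := quotient_span_singleton hx hx2
    have := isDomain R
    have hreg : IsSMulRegular R x :=
      .of_ne_zero (by rintro rfl; exact hx2 (zero_mem _))
    have hfin : (maximalIdeal (R ⧸ Ideal.span {x})).spanFinrank = n := by
      have h := ringKrullDim_quotient_span_singleton_succ_eq_ringKrullDim hreg hx
      rw [← spanFinrank_maximalIdeal, ← spanFinrank_maximalIdeal, hn] at h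
      exact Nat.succ_injective (by exact_mod_cast h)
    obtain ⟨rs, hlen, hmem, hrs⟩ := ih _ hfin
    obtain ⟨rs, rfl⟩ := List.map_surjective_iff.mpr Ideal.Quotient.mk_surjective rs
    have hmem' : ∀ r ∈ x :: rs, r ∈ maximalIdeal R := by
      rintro r hr
      rcases List.mem_cons.mp hr with rfl | hr
      · exact hx
      · have : IsLocalHom (Ideal.Quotient.mk (Ideal.span {x})) :=
          .of_surjective _ Ideal.Quotient.mk_surjective
        rw [← maximalIdeal_comap (Ideal.Quotient.mk (Ideal.span {x}))]
        exact hmem _ (List.mem_map_of_mem hr)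
    refine ⟨x :: rs, by simpa using hlen, hmem', ?_⟩
    rw [IsLocalRing.isRegular_iff_isWeaklyRegular_of_subset_maximalIdeal hmem',
      isWeaklyRegular_cons_iff]
    refine ⟨hreg, ?_⟩
    have e : QuotSMulTop x R ≃ₗ[R] R ⧸ Ideal.span {x} :=
      Submodule.quotEquivOfEq _ _ (by rw [← Submodule.ideal_span_singleton_smul]; simp)
    rw [e.isWeaklyRegular_congr, ← isWeaklyRegular_map_algebraMap_iff (R ⧸ Ideal.span {x})]
    exact hrs.1

open CategoryTheory Abelian Limits Pointwise in
theorem subsingleton_linearMap_quotient_ofList_of_subsingleton_ext.{u} {R : Type u} [CommRing R]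
    (N : ModuleCat.{u} R) (rs : List R) (M : ModuleCat.{u} R) (hrs : IsWeaklyRegular M rs)
    (hext : ∀ i ≤ rs.length, Subsingleton (Ext N M i)) :
    Subsingleton (N →ₗ[R] (M ⧸ (Ideal.ofList rs • (⊤ : Submodule R M)))) := by
  induction rs generalizing M with
  | nil =>
    have : Subsingleton (N ⟶ M) := Ext.addEquiv₀.subsingleton_congr.mp (hext 0 le_rfl)
    have : Subsingleton (N →ₗ[R] M) := ModuleCat.homAddEquiv.symm.subsingleton
    let e : (M ⧸ (Ideal.ofList ([] : List R) • (⊤ : Submodule R M))) ≃ₗ[R] M :=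
      Submodule.quotEquivOfEqBot _ (by simp)
    exact ((LinearEquiv.congrRight e).toEquiv).subsingleton
  | cons r rs ih =>
    rw [isWeaklyRegular_cons_iff] at hrs
    have h := ih (ModuleCat.of R (QuotSMulTop r M)) hrs.2 fun i hi ↦ by
      have zero1 := AddCommGrpCat.isZero_of_iff_subsingleton.mpr
        (hext i (by simp; omega))
      have zero2 := AddCommGrpCat.isZero_of_iff_subsingleton.mpr
        (hext (i + 1) (by simp; omega))
      exact AddCommGrpCat.subsingleton_of_isZero <| ShortComplex.Exact.isZero_of_both_zeros
        ((Ext.covariant_sequence_exact₃' N hrs.1.smulShortComplex_shortExact) i (i + 1) rfl)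
        (zero1.eq_zero_of_src _) (zero2.eq_zero_of_tgt _)
    exact (LinearEquiv.congrRight (M := N)
      (Submodule.quotOfListConsSMulTopEquivQuotSMulTopInner M r rs)).toEquiv.subsingleton

theorem IsRegularLocalRing.spanFinrank_le_length {O : Type*} [CommRing O] [IsRegularLocalRing O]
    {rs : List O} (hrs : IsWeaklyRegular O rs) {u : O} (hu : u ∉ Ideal.ofList rs)
    (hmu : ∀ r ∈ maximalIdeal O, r * u ∈ Ideal.ofList rs) :
    (maximalIdeal O).spanFinrank ≤ rs.length := by
  by_contra! hlt
  obtain ⟨xs, hlen, hmem, hxs⟩ := exists_isRegular O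
  have htop : maximalIdeal O • (⊤ : Submodule O O) < ⊤ := by
    rw [smul_eq_mul, Ideal.mul_top]
    exact lt_top_iff_ne_top.mpr (maximalIdeal.isMaximal O).ne_top
  have hext := ModuleCat.subsingleton_ext_of_exists_isRegular (maximalIdeal O)
    (ModuleCat.of O (O ⧸ maximalIdeal O))
    (by rw [Module.support_eq_zeroLocus, Ideal.annihilator_quotient])
    (ModuleCat.of O O) htop xs hmem hxs
  have hsub := subsingleton_linearMap_quotient_ofList_of_subsingleton_ext
    (ModuleCat.of O (O ⧸ maximalIdeal O)) rs (ModuleCat.of O O) hrs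
    fun i hi ↦ hext i (by omega)
  have hmem_iff (x : O) : x ∈ Ideal.ofList rs • (⊤ : Submodule O O) ↔ x ∈ Ideal.ofList rs := by
    rw [smul_eq_mul, Ideal.mul_top]
  let φ : (O ⧸ maximalIdeal O) →ₗ[O] O ⧸ (Ideal.ofList rs • (⊤ : Submodule O O)) :=
    (maximalIdeal O).liftQ ((Submodule.mkQ _) ∘ₗ (LinearMap.toSpanSingleton O O u)) fun r hr ↦ by
      rw [LinearMap.mem_ker, LinearMap.comp_apply, Submodule.mkQ_apply,
        Submodule.Quotient.mk_eq_zero, hmem_iff]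
      exact hmu r hr
  have h0 : φ (Submodule.Quotient.mk 1) = 0 := by
    have : φ = 0 := hsub.elim _ _
    rw [this]; rfl
  refine hu ((hmem_iff u).mp ?_)
  have h1 : φ (Submodule.Quotient.mk 1) = Submodule.Quotient.mk u := by
    change Submodule.Quotient.mk ((1 : O) • u) = _
    rw [one_smul]
  rw [h1, Submodule.Quotient.mk_eq_zero] at h0
  exact h0

theorem RingTheory.Sequence.IsWeaklyRegular.height_le_length {R : Type*} [CommRing R]
    [IsRegularRing R] {rs : List R} (hrs : IsWeaklyRegular R rs) {P : Ideal R} [P.IsPrime] {u : R}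
    (hu : ∀ r, r * u ∈ Ideal.ofList rs ↔ r ∈ P) : P.height ≤ rs.length := by
  set O := Localization.AtPrime P
  have hmap : Ideal.ofList (rs.map (algebraMap R O)) = (Ideal.ofList rs).map (algebraMap R O) :=
    (Ideal.map_ofList _ _).symm
  have hreg : IsWeaklyRegular O (rs.map (algebraMap R O)) :=
    hrs.of_isLocalization O P.primeCompl
  have h := IsRegularLocalRing.spanFinrank_le_length (O := O) hreg (u := algebraMap R O u) ?_ ?_
  · rw [List.length_map] at h
    have h2 : ((maximalIdeal O).spanFinrank : WithBot ℕ∞) = ringKrullDim O :=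
      IsRegularLocalRing.spanFinrank_maximalIdeal
    rw [IsLocalization.AtPrime.ringKrullDim_eq_height P O] at h2
    have h3 : ((maximalIdeal O).spanFinrank : ℕ∞) = P.height := by exact_mod_cast h2
    rw [← h3]
    exact_mod_cast h
  · rw [hmap, IsLocalization.algebraMap_mem_map_algebraMap_iff P.primeCompl]
    rintro ⟨s, hs, hsu⟩
    exact hs ((hu s).mp hsu)
  · rw [hmap, ← Localization.AtPrime.map_eq_maximalIdeal]
    intro r hr
    have : Ideal.map (algebraMap R O) P ≤
        ((Ideal.ofList rs).map (algebraMap R O)).colon {algebraMap R O u} := by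
      rw [Ideal.map_le_iff_le_comap]
      intro a ha
      rw [Ideal.mem_comap, Submodule.mem_colon_singleton, smul_eq_mul, ← map_mul]
      exact Ideal.mem_map_of_mem _ ((hu a).mpr ha)
    simpa [Submodule.mem_colon_singleton] using this hr

theorem exists_isPrime_le_of_notMem {ι A : Type*} [DecidableEq ι] [CommRing A] (f g : ι → A)
    (Q : Ideal (MvPolynomial (ι × Fin 2) A)) [Q.IsPrime] (i : ι)
    (hi : ¬ (C (f i) ∈ Q ∧ C (g i) ∈ Q)) :
    ∃ Q' : Ideal (MvPolynomial (ι × Fin 2) A), Q'.IsPrime ∧ Q' ≤ Q ∧ Q'.comap C = Q.comap C ∧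
      X (i, 0) * C (g i) - X (i, 1) * C (f i) ∉ Q' ∧
      ∀ j ≠ i, X (j, 0) * C (g j) - X (j, 1) * C (f j) ∈ Q →
        X (j, 0) * C (g j) - X (j, 1) * C (f j) ∈ Q' := by
  let π := Ideal.Quotient.mk Q
  let ψ : MvPolynomial (ι × Fin 2) A →+* MvPolynomial (Fin 2) (MvPolynomial (ι × Fin 2) A ⧸ Q) :=
    eval₂Hom (C.comp (π.comp C)) fun a ↦ if a.1 = i then X a.2 else C (π (X a))
  have hψC (a : A) : ψ (C a) = C (π (C a)) := by simp [ψ]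
  have hψi (e : Fin 2) : ψ (X (i, e)) = X e := by simp [ψ]
  have hψj (j : ι) (hj : j ≠ i) (e : Fin 2) : ψ (X (j, e)) = C (π (X (j, e))) := by simp [ψ, hj]
  have hcomp : (eval fun e ↦ π (X (i, e))).comp ψ = π := by
    refine ringHom_ext (fun a ↦ by simp [hψC]) fun ⟨j, e⟩ ↦ ?_
    by_cases hj : j = i
    · subst hj; simp [hψi]
    · simp [hψj j hj]
  refine ⟨RingHom.ker ψ, RingHom.ker_isPrime ψ, fun r hr ↦ ?_, ?_, ?_, fun j hj hjQ ↦ ?_⟩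
  · rw [← Ideal.Quotient.eq_zero_iff_mem, ← RingHom.congr_fun hcomp, RingHom.comp_apply,
      RingHom.mem_ker.mp hr, map_zero]
  · ext a
    rw [Ideal.mem_comap, Ideal.mem_comap, RingHom.mem_ker, hψC, map_eq_zero_iff _ (C_injective _ _),
      Ideal.Quotient.eq_zero_iff_mem]
  · rw [RingHom.mem_ker]
    simp only [map_sub, map_mul, hψi, hψC]
    intro h
    refine hi ⟨?_, ?_⟩
    · have := congrArg (eval ![0, 1]) h
      simpa [π, Ideal.Quotient.eq_zero_iff_mem] using this
    · have := congrArg (eval ![1, 0]) h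
      simpa [π, Ideal.Quotient.eq_zero_iff_mem] using this
  · rw [RingHom.mem_ker]
    simp only [map_sub, map_mul, hψj j hj, hψC]
    rw [← C_mul, ← C_mul, ← C_sub, ← map_mul, ← map_mul, ← map_sub,
      Ideal.Quotient.eq_zero_iff_mem.mpr hjQ, C_0]

theorem height_comap_C_add_card_le {ι A : Type*} [CommRing A] [IsNoetherianRing A]
    [Finite ι] (f g : ι → A) (T : Finset ι)
    (Q : Ideal (MvPolynomial (ι × Fin 2) A)) [Q.IsPrime]
    (hT : ∀ i ∈ T, X (i, 0) * C (g i) - X (i, 1) * C (f i) ∈ Q ∧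
      ¬ (C (f i) ∈ Q ∧ C (g i) ∈ Q)) :
    (Q.comap C).height + T.card ≤ Q.height := by
  classical
  induction T using Finset.induction generalizing Q with
  | empty =>
    have : Q.LiesOver (Q.comap (algebraMap A (MvPolynomial (ι × Fin 2) A))) := ⟨rfl⟩
    have h := Ideal.height_eq_height_add_of_liesOver_of_hasGoingDown
      (Q.comap (algebraMap A (MvPolynomial (ι × Fin 2) A))) Q
    rw [h, Finset.card_empty, Nat.cast_zero, add_zero]
    exact le_self_add
  | insert i T hiT ih =>
    obtain ⟨hiQ, hi⟩ := hT i (Finset.mem_insert_self _ _)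
    obtain ⟨Q', hQ', hle, hcomap, hni, hj⟩ := exists_isPrime_le_of_notMem f g Q i hi
    have hC (a : A) : C a ∈ Q' ↔ C a ∈ Q := by
      rw [← Ideal.mem_comap, hcomap, Ideal.mem_comap]
    have h := ih Q' fun j hjT ↦ by
      obtain ⟨h1, h2⟩ := hT j (Finset.mem_insert_of_mem hjT)
      exact ⟨hj j (by rintro rfl; exact hiT hjT) h1, by rwa [hC, hC]⟩
    have hlt : Q' < Q := lt_of_le_of_ne hle (by rintro rfl; exact hni hiQ)
    rw [Finset.card_insert_of_notMem hiT, Nat.cast_add, Nat.cast_one, ← add_assoc, ← hcomap]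
    exact (by gcongr : _ ≤ _).trans (Ideal.height_add_one_le_of_lt_of_isPrime hlt)

theorem Ideal.sum_powersetCard_prod_le_iff {A ι : Type*} [CommRing A] [Fintype ι]
    (I : ι → Ideal A) (P : Ideal A) [hP : P.IsPrime] [DecidablePred fun i ↦ I i ≤ P] (r : ℕ) :
    ∑ α ∈ Finset.powersetCard r (Finset.univ : Finset ι), ∏ i ∈ α, I i ≤ P ↔
      Fintype.card ι < r + (Finset.univ.filter fun i ↦ I i ≤ P).card := by
  classical
  rw [Ideal.sum_eq_sup, Finset.sup_le_iff]
  simp only [Finset.mem_powersetCard_univ, hP.prod_le]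
  have hcard := Finset.card_filter_add_card_filter_not (s := Finset.univ) fun i ↦ I i ≤ P
  rw [Finset.card_univ] at hcard
  refine ⟨fun h ↦ ?_, fun h b hb ↦ ?_⟩
  · by_contra! hle
    obtain ⟨b, hb, hbr⟩ := Finset.exists_subset_card_eq
      (show r ≤ (Finset.univ.filter fun i ↦ ¬ I i ≤ P).card by omega)
    obtain ⟨i, hi, hiP⟩ := h b hbr
    exact (Finset.mem_filter.mp (hb hi)).2 hiP
  · by_contra! hbP
    have := Finset.card_le_card (s := b) (t := Finset.univ.filter fun i ↦ ¬ I i ≤ P)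
      fun i hi ↦ by simpa using hbP i hi
    omega

theorem IsRegularSeq.le_height {R : Type*} [CommRing R] [IsNoetherianRing R] {m : ℕ}
    {L : Fin m → R} (hL : IsRegularSeq L) {j : ℕ} (hj : j ≤ m) (Q : Ideal R) [Q.IsPrime]
    (hQ : ∀ i : Fin m, i.val < j → L i ∈ Q) : j ≤ Q.height := by
  induction j generalizing Q with
  | zero => simp
  | succ j ih =>
    let i : Fin m := ⟨j, hj⟩
    have hle : Ideal.span (L '' {a | a < i}) ≤ Q := by
      rw [Ideal.span_le]
      rintro _ ⟨a, ha, rfl⟩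
      exact hQ a (Nat.lt_succ_of_lt ha)
    obtain ⟨Q', hQ', hQle⟩ := Ideal.exists_minimalPrimes_le hle
    have := hQ'.1.1
    have h := ih (Nat.le_of_succ_le hj) Q' fun a ha ↦
      hQ'.1.2 (Ideal.subset_span ⟨a, ha, rfl⟩)
    have hni : L i ∉ Q' := fun hi ↦ by
      obtain ⟨y, hy, hxy⟩ := Ideal.exists_mul_mem_of_mem_minimalPrimes hQ' hi
      exact hy (hL.1 i y (mul_comm y _ ▸ hxy))
    have hlt : Q' < Q := lt_of_le_of_ne hQle
      (by rintro rfl; exact hni (hQ i (Nat.lt_succ_self j)))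
    rw [Nat.cast_add, Nat.cast_one]
    exact (by gcongr : _ ≤ _).trans (Ideal.height_add_one_le_of_lt_of_isPrime hlt)

theorem mem_of_mul_mem_of_lt_height {R : Type*} [CommRing R] [IsRegularRing R]
    {rs : List R} (hrs : IsWeaklyRegular R rs) {x : R}
    (hx : ∀ P : Ideal R, P.IsPrime → Ideal.ofList rs ≤ P → x ∈ P → rs.length < P.height)
    {p : R} (hp : p * x ∈ Ideal.ofList rs) : p ∈ Ideal.ofList rs := by
  by_contra hpn
  obtain ⟨P, hP, hle⟩ := exists_le_isAssociatedPrime_of_isNoetherianRing R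
    (M := R ⧸ Ideal.ofList rs) (Ideal.Quotient.mk _ p)
    (by rwa [Ne, Ideal.Quotient.eq_zero_iff_mem])
  obtain ⟨hprime, y, rfl⟩ := isAssociatedPrime_iff.mp hP
  obtain ⟨u, rfl⟩ := Ideal.Quotient.mk_surjective y
  have hmem (v r : R) : r ∈ (⊥ : Submodule R (R ⧸ Ideal.ofList rs)).colon
      {Ideal.Quotient.mk _ v} ↔ r * v ∈ Ideal.ofList rs := by
    rw [Submodule.mem_colon_singleton, Submodule.mem_bot, ← Ideal.Quotient.eq_zero_iff_mem,
      map_mul, Algebra.smul_def]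
    rfl
  refine (hx _ hprime (fun r hr ↦ ?_) (hle ?_)).not_ge
    (hrs.height_le_length (u := u) fun r ↦ (hmem u r).symm)
  · exact (hmem u r).mpr (Ideal.mul_mem_right _ _ hr)
  · exact (hmem p x).mpr (mul_comm p x ▸ hp)

theorem ofList_take_ofFn {R : Type*} [CommRing R] {m : ℕ} (L : Fin m → R) (j : ℕ) :
    Ideal.ofList ((List.ofFn L).take j) = Ideal.span (L '' {i | i.val < j}) := by
  rw [Ideal.ofList]
  congr 1
  ext x
  simp only [Set.mem_ofPred_eq, List.mem_take_iff_getElem, List.getElem_ofFn, Set.mem_image,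
    List.length_ofFn]
  constructor
  · rintro ⟨i, hi, rfl⟩
    exact ⟨⟨i, by omega⟩, by simp; omega, rfl⟩
  · rintro ⟨i, hi, rfl⟩
    exact ⟨i, by omega, rfl⟩

theorem mem_span_image_of_mul_mem_of_lt_height {R : Type*} [CommRing R] [IsRegularRing R] {m : ℕ}
    (L : Fin m → R)
    (h : ∀ P : Ideal R, P.IsPrime → ∀ j : Fin m, (∀ i ≤ j, L i ∈ P) → j.val < P.height)
    (j : Fin m) (p : R) (hp : p * L j ∈ Ideal.span (L '' {i | i < j})) :
    p ∈ Ideal.span (L '' {i | i < j}) := by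
  have key (j : Fin m) (hrs : IsWeaklyRegular R ((List.ofFn L).take j)) (p : R)
      (hp : p * L j ∈ Ideal.ofList ((List.ofFn L).take j)) :
      p ∈ Ideal.ofList ((List.ofFn L).take j) := by
    refine mem_of_mul_mem_of_lt_height hrs (fun P hP hle hj ↦ ?_) hp
    have hlen : ((List.ofFn L).take j).length = j := by simp
    rw [hlen]
    refine h P hP j fun i hi ↦ ?_
    rcases hi.lt_or_eq with hi | rfl
    · exact hle (ofList_take_ofFn L j ▸ Ideal.subset_span ⟨i, hi, rfl⟩)
    · exact hj
  have hreg (j : ℕ) (hj : j ≤ m) : IsWeaklyRegular R ((List.ofFn L).take j) := by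
    induction j with
    | zero => simp
    | succ j ih =>
      have hr := ih (Nat.le_of_succ_le hj)
      rw [List.take_succ_eq_append_getElem (by simpa using hj), isWeaklyRegular_append_iff,
        isWeaklyRegular_singleton_iff]
      refine ⟨hr, ?_⟩
      have hmem (x : R) : x ∈ Ideal.ofList ((List.ofFn L).take j) • (⊤ : Submodule R R) ↔
          x ∈ Ideal.ofList ((List.ofFn L).take j) := by
        rw [smul_eq_mul, Ideal.mul_top]
      rw [isSMulRegular_iff_right_eq_zero_of_smul]
      intro y hy
      obtain ⟨y, rfl⟩ := Submodule.Quotient.mk_surjective _ y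
      rw [← Submodule.Quotient.mk_smul, Submodule.Quotient.mk_eq_zero, hmem, smul_eq_mul,
        List.getElem_ofFn, mul_comm] at hy
      rw [Submodule.Quotient.mk_eq_zero, hmem]
      exact key ⟨j, hj⟩ hr y hy
  have := key j (hreg j j.2.le) p
  rw [ofList_take_ofFn] at this
  exact this hp

theorem exists_isPrime_comap_C_eq_and_height_le {ι A : Type*} [Finite ι] [CommRing A]
    [IsNoetherianRing A] (f g : ι → A) (p : Ideal A) [p.IsPrime] (T : Finset ι) :
    ∃ Q : Ideal (MvPolynomial (ι × Fin 2) A), Q.IsPrime ∧ Q.comap C = p ∧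
      (∀ i ∈ T, X (i, 0) * C (g i) - X (i, 1) * C (f i) ∈ Q) ∧
      Q.height ≤ p.height + T.card := by
  classical
  let S := MvPolynomial (ι × Fin 2) A
  let l (i : ι) : S := X (i, 0) * C (g i) - X (i, 1) * C (f i)
  let φ : S →+* A ⧸ p := eval₂Hom (Ideal.Quotient.mk p) fun _ ↦ 0
  have hφC (a : A) : φ (C a) = Ideal.Quotient.mk p a := eval₂Hom_C _ _ _
  have hφX (a : ι × Fin 2) : φ (X a) = 0 := eval₂Hom_X' _ _ _
  let π := Ideal.Quotient.mk (p.map (algebraMap A S))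
  have hle : p.map (algebraMap A S) ≤ RingHom.ker φ := by
    rw [Ideal.map_le_iff_le_comap]
    intro a ha
    rw [Ideal.mem_comap, RingHom.mem_ker, MvPolynomial.algebraMap_eq, hφC,
      Ideal.Quotient.eq_zero_iff_mem.mpr ha]
  have hφprime := RingHom.ker_isPrime φ
  let φ' : S ⧸ p.map (algebraMap A S) →+* A ⧸ p := Ideal.Quotient.lift _ φ hle
  have hφ'prime := RingHom.ker_isPrime φ'
  have hspan : Ideal.span (T.image (π ∘ l) : Set (S ⧸ p.map (algebraMap A S))) ≤
      RingHom.ker φ' := by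
    rw [Ideal.span_le]
    intro x hx
    obtain ⟨i, -, rfl⟩ := Finset.mem_image.mp (Finset.mem_coe.mp hx)
    change φ (l i) = 0
    simp only [l, map_sub, map_mul, hφX, zero_mul, sub_zero]
  obtain ⟨q, hq, hqle⟩ := Ideal.exists_minimalPrimes_le hspan
  have hqp := hq.1.1
  have hcomap : (q.comap π).comap C = p := by
    ext a
    refine ⟨fun ha ↦ ?_, fun ha ↦ ?_⟩
    · have h := hqle ha
      rw [RingHom.mem_ker] at h
      rw [← Ideal.Quotient.eq_zero_iff_mem, ← hφC]
      exact h
    · have h : π (C a) = 0 :=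
        Ideal.Quotient.eq_zero_iff_mem.mpr (Ideal.mem_map_of_mem (algebraMap A S) ha)
      rw [Ideal.mem_comap, Ideal.mem_comap, h]
      exact zero_mem _
  refine ⟨q.comap π, inferInstance, hcomap, fun i hi ↦ ?_, ?_⟩
  · exact hq.1.2 (Ideal.subset_span (Finset.mem_coe.mpr (Finset.mem_image_of_mem (π ∘ l) hi)))
  · have : (q.comap π).LiesOver p := ⟨hcomap.symm⟩
    refine (Ideal.height_le_height_add_of_liesOver p (q.comap π)).trans ?_
    gcongr
    rw [Ideal.map_comap_of_surjective _ Ideal.Quotient.mk_surjective]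
    refine (Ideal.height_le_card_of_mem_minimalPrimes_span (Finset.finite_toSet _) hq).trans ?_
    rw [Set.ncard_coe_finset]
    exact_mod_cast Finset.card_image_le

end

/-- With `A = k[t₀,…,tₙ]`, `R = A[x₀,y₀,…,xₙ,yₙ]`
(realized as `MvPolynomial (Fin (n+1) × Fin 2) A`, with `x_i = X (i,0)`, `y_i = X (i,1)`),
`L_i = x_i g_i − y_i f_i` and `I⁽ⁱ⁾ = (f_i, g_i) ⊆ A`, the following are equivalent:
(1) `L₀,…,Lₙ` is a regular sequence in `R`;
(2) for every `1 ≤ r ≤ n+1`, the height of `Σ_{|α| = r} ∏_{i∈α} I⁽ⁱ⁾` is `≥ n+2−r`. -/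
theorem stmt4 {k : Type*} [Field k] (n : ℕ)
    (f g : Fin (n + 1) → MvPolynomial (Fin (n + 1)) k)
    (d : Fin (n + 1) → ℕ) (hd : ∀ i, 1 ≤ d i)
    (hf0 : ∀ i, f i ≠ 0) (hg0 : ∀ i, g i ≠ 0)
    (hfhom : ∀ i, (f i).IsHomogeneous (d i)) (hghom : ∀ i, (g i).IsHomogeneous (d i))
    (L : Fin (n + 1) → MvPolynomial (Fin (n + 1) × Fin 2) (MvPolynomial (Fin (n + 1)) k))
    (hL : ∀ i, L i = X (i, 0) * C (g i) - X (i, 1) * C (f i)) :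
    IsRegularSeq L ↔
      ∀ r : ℕ, 1 ≤ r → r ≤ n + 1 →
        ((n + 2 - r : ℕ) : ℕ∞) ≤
          idealHeight (∑ α ∈ Finset.powersetCard r (Finset.univ : Finset (Fin (n + 1))),
            ∏ i ∈ α, Ideal.span ({f i, g i} : Set (MvPolynomial (Fin (n + 1)) k))) := by
  classical
  obtain rfl : L = fun i ↦ X (i, 0) * C (g i) - X (i, 1) * C (f i) := funext hL
  have hspan (i : Fin (n + 1)) (p : Ideal (MvPolynomial (Fin (n + 1)) k)) :
      Ideal.span ({f i, g i} : Set (MvPolynomial (Fin (n + 1)) k)) ≤ p ↔ f i ∈ p ∧ g i ∈ p := by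
    rw [Ideal.span_le, Set.insert_subset_iff, Set.singleton_subset_iff]
    rfl
  have hheight (J : Ideal (MvPolynomial (Fin (n + 1)) k)) (a : ℕ∞) :
      a ≤ idealHeight J ↔
        ∀ p : PrimeSpectrum (MvPolynomial (Fin (n + 1)) k),
          J ≤ p.asIdeal → a ≤ p.asIdeal.height := by
    simp only [idealHeight, le_iInf_iff, PrimeSpectrum.height_eq_orderHeight]
    rfl
  simp only [hheight, Ideal.sum_powersetCard_prod_le_iff, hspan, Fintype.card_fin]
  refine ⟨fun hreg r hr hrn p hp ↦ ?_, fun h ↦ ⟨?_, ?_⟩⟩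
  · obtain ⟨Q, hQ, hcomap, hmem, hle⟩ := exists_isPrime_comap_C_eq_and_height_le f g p.asIdeal
      (Finset.univ.filter fun i ↦ ¬ (f i ∈ p.asIdeal ∧ g i ∈ p.asIdeal))
    have hcard := Finset.card_filter_add_card_filter_not (s := Finset.univ)
      fun i ↦ f i ∈ p.asIdeal ∧ g i ∈ p.asIdeal
    rw [Finset.card_univ, Fintype.card_fin] at hcard
    have hQ' := (hreg.le_height le_rfl Q fun i _ ↦ ?_).trans hle
    · replace hQ' := le_of_eq_of_le (congrArg Nat.cast hcard) hQ'
      rw [Nat.cast_add] at hQ'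
      have hS := (ENat.add_le_add_iff_right (ENat.natCast_ne_top _)).mp hQ'
      exact le_trans (by exact_mod_cast (by omega)) hS
    · by_cases hi : f i ∈ p.asIdeal ∧ g i ∈ p.asIdeal
      · rw [← hcomap, Ideal.mem_comap, Ideal.mem_comap] at hi
        exact sub_mem (Ideal.mul_mem_left _ _ hi.2) (Ideal.mul_mem_left _ _ hi.1)
      · exact hmem i (Finset.mem_filter.mpr ⟨Finset.mem_univ i, hi⟩)
  · refine mem_span_image_of_mul_mem_of_lt_height _ fun P hP j hj ↦ ?_
    set p := P.comap C with hp
    set S := Finset.univ.filter fun i ↦ f i ∈ p ∧ g i ∈ p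
    set T := (Finset.Iic j).filter fun i ↦ ¬ (f i ∈ p ∧ g i ∈ p)
    have hS : (S.card : ℕ∞) ≤ p.height := by
      rcases Nat.eq_zero_or_pos S.card with h0 | h0
      · simp [h0]
      · have hSn : S.card ≤ n + 1 := by simpa using S.card_le_univ
        have := h (n + 2 - S.card) (by omega) (by omega) ⟨p, inferInstance⟩
          (by change n + 1 < n + 2 - S.card + S.card; omega)
        rwa [show n + 2 - (n + 2 - S.card) = S.card by omega] at this
    have hcard : j.val + 1 ≤ S.card + T.card := by
      rw [← Fin.card_Iic, ← Finset.card_filter_add_card_filter_not fun i ↦ f i ∈ p ∧ g i ∈ p]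
      gcongr
      exact Finset.filter_subset_filter _ (Finset.subset_univ _)
    have hT := height_comap_C_add_card_le f g T P fun i hi ↦
      ⟨hj i (Finset.mem_Iic.mp (Finset.mem_filter.mp hi).1), (Finset.mem_filter.mp hi).2⟩
    rw [← hp] at hT
    refine lt_of_lt_of_le ?_ ((add_le_add_left hS _).trans hT)
    exact_mod_cast hcard
  · refine ne_top_of_le_ne_top (RingHom.ker_ne_top
      (eval₂Hom (RingHom.id (MvPolynomial (Fin (n + 1)) k)) fun _ : Fin (n + 1) × Fin 2 ↦ 0)) ?_
    rw [Ideal.span_le]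
    rintro _ ⟨i, rfl⟩
    simp
end

section
/- Let k be a field, A = k[t_0,…,t_n], and for i = 0,…,n let f_i, g_i ∈ A be nonzero homogeneous polynomials of degree d_i ≥ 1. Set R = A[x_0,y_0,…,x_n,y_n], L_i = x_i·g_i − y_i·f_i ∈ R, and I^{(i)} = (f_i,g_i) ⊆ A. If L_0,…,L_n is a regular sequence in R, then for every k with 0 ≤ k ≤ n and every subset {i_0,…,i_k} ⊆ {0,…,n} of cardinality k+1, the height in A of the ideal I^{(i_0)} + ⋯ + I^{(i_k)} is at least k+1. -/
open MvPolynomial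

/-- A prime containing the first `m` members of a regular sequence has height at least `m`. -/
theorem le_height_of_isRegularSeq {R : Type*} [CommRing R] {N : ℕ} {L : Fin N → R}
    (hL : IsRegularSeq L) (m : ℕ) (hm : m ≤ N) (P : Ideal R) [P.IsPrime]
    (hP : ∀ i : Fin N, i.val < m → L i ∈ P) : (m : ℕ∞) ≤ P.height := by
  induction m generalizing P with
  | zero => simp
  | succ m ih =>
    let j : Fin N := ⟨m, hm⟩
    have hIP : Ideal.span (L '' {i : Fin N | i < j}) ≤ P := by
      rw [Ideal.span_le]
      rintro _ ⟨i, hi, rfl⟩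
      exact hP i (Nat.lt_succ_of_lt hi)
    obtain ⟨Q, hQ, hQP⟩ := Ideal.exists_minimalPrimes_le hIP
    have hQprime : Q.IsPrime := hQ.isPrime
    have hjQ : L j ∉ Q := by
      intro h
      obtain ⟨y, hy, hxy⟩ := Ideal.exists_mul_mem_of_mem_minimalPrimes hQ h
      exact hy (hL.1 j y (by rwa [mul_comm]))
    have hlt : Q < P :=
      lt_of_le_of_ne hQP fun h => hjQ (h ▸ hP j (Nat.lt_succ_self m))
    have hQm : (m : ℕ∞) ≤ Q.height :=
      ih (by omega) Q fun i hi => hQ.le (Ideal.subset_span ⟨i, hi, rfl⟩)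
    calc ((m + 1 : ℕ) : ℕ∞) = (m : ℕ∞) + 1 := by push_cast; rfl
      _ ≤ Q.height + 1 := by gcongr
      _ ≤ P.height := Ideal.height_add_one_le_of_lt_of_isPrime hlt

/-- If a prime `Q` lying over `p` contains a finite set `s`, then some prime between
`pB + (s)` and `Q` has height at most `ht p + |s|`. -/
theorem exists_isPrime_height_le_height_add_card {A B : Type*} [CommRing A] [CommRing B]
    [Algebra A B] [IsNoetherianRing A] [IsNoetherianRing B] (p : Ideal A) [p.IsPrime]
    (Q : Ideal B) [Q.IsPrime] [hQp : Q.LiesOver p] (s : Finset B) (hs : (s : Set B) ⊆ Q) :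
    ∃ P : Ideal B, P.IsPrime ∧ p.map (algebraMap A B) ≤ P ∧ (s : Set B) ⊆ P ∧
      P.height ≤ p.height + s.card := by
  classical
  set J := p.map (algebraMap A B)
  have hJQ : J ≤ Q := Ideal.map_le_iff_le_comap.mpr hQp.over.le
  obtain ⟨P, hP, hPQ⟩ :=
    Ideal.exists_minimalPrimes_le (sup_le hJQ (Ideal.span_le.mpr hs))
  have hPprime : P.IsPrime := hP.isPrime
  have hJP : J ≤ P := le_sup_left.trans hP.le
  have : P.LiesOver p := ⟨le_antisymm (Ideal.map_le_iff_le_comap.mp hJP)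
    ((Ideal.comap_mono hPQ).trans hQp.over.ge)⟩
  refine ⟨P, hPprime, hJP, Ideal.span_le.mp (le_sup_right.trans hP.le), ?_⟩
  refine (Ideal.height_le_height_add_of_liesOver p P).trans ?_
  gcongr
  have hmin : P.map (Ideal.Quotient.mk J) ∈
      (Ideal.span ((s.image (Ideal.Quotient.mk J) : Finset (B ⧸ J)) : Set (B ⧸ J))).minimalPrimes := by
    rw [Finset.coe_image, ← Ideal.map_span,
      Ideal.minimalPrimes_map_of_surjective Ideal.Quotient.mk_surjective, Ideal.mk_ker]
    exact ⟨P, by rwa [sup_comm], rfl⟩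
  exact (Ideal.height_le_card_of_mem_minimalPrimes_span_finset hmin).trans
    (by exact_mod_cast Finset.card_image_le)

/-- **Lemma 4.5.** With `A = k[t₀,…,tₙ]`,
`R = A[x₀,y₀,…,xₙ,yₙ] = MvPolynomial (Fin (n+1) × Fin 2) A`,
`L_i = x_i g_i − y_i f_i` and `I⁽ⁱ⁾ = (f_i, g_i) ⊆ A`: if `L₀,…,Lₙ` is a regular
sequence in `R`, then for every `0 ≤ k ≤ n` and every subset `{i₀,…,i_k}` of
`{0,…,n}` of cardinality `k+1`, the height of `I^{(i₀)} + ⋯ + I^{(i_k)}` is `≥ k+1`. -/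
theorem stmt5 {K : Type*} [Field K] (n : ℕ)
    (f g : Fin (n + 1) → MvPolynomial (Fin (n + 1)) K)
    (d : Fin (n + 1) → ℕ) (hd : ∀ i, 1 ≤ d i)
    (hf0 : ∀ i, f i ≠ 0) (hg0 : ∀ i, g i ≠ 0)
    (hfhom : ∀ i, (f i).IsHomogeneous (d i)) (hghom : ∀ i, (g i).IsHomogeneous (d i))
    (L : Fin (n + 1) → MvPolynomial (Fin (n + 1) × Fin 2) (MvPolynomial (Fin (n + 1)) K))
    (hL : ∀ i, L i = X (i, 0) * C (g i) - X (i, 1) * C (f i))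
    (hreg : IsRegularSeq L) :
    ∀ k : ℕ, k ≤ n → ∀ S : Finset (Fin (n + 1)), S.card = k + 1 →
      ((k + 1 : ℕ) : ℕ∞) ≤
        idealHeight (∑ i ∈ S, Ideal.span ({f i, g i} : Set (MvPolynomial (Fin (n + 1)) K))) := by
  intro k hk S hS
  refine le_iInf₂ fun p hp => ?_
  rw [← PrimeSpectrum.height_eq_orderHeight]
  have hfg : ∀ i ∈ S, f i ∈ p.asIdeal ∧ g i ∈ p.asIdeal := by
    intro i hi
    have hle : Ideal.span {f i, g i} ≤ p.asIdeal := by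
      refine le_trans ?_ hp
      rw [Ideal.sum_eq_sup]
      exact Finset.le_sup (f := fun i => Ideal.span {f i, g i}) hi
    exact ⟨hle (Ideal.subset_span (by simp)), hle (Ideal.subset_span (by simp))⟩
  let Q : Ideal (MvPolynomial (Fin (n + 1) × Fin 2) (MvPolynomial (Fin (n + 1)) K)) :=
    p.asIdeal.comap constantCoeff
  have hQp : Q.LiesOver p.asIdeal := ⟨by
    ext a
    simp [Q, Ideal.under, Ideal.mem_comap, MvPolynomial.algebraMap_eq]⟩
  classical
  let s := Sᶜ.image L
  have hsQ : ∀ x ∈ s, x ∈ Q := by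
    intro x hx
    obtain ⟨i, -, rfl⟩ := Finset.mem_image.mp hx
    simp [Q, hL, Ideal.mem_comap]
  obtain ⟨P, hP, hpP, hsP, hht⟩ :=
    exists_isPrime_height_le_height_add_card p.asIdeal Q s hsQ
  have hLP : ∀ i, L i ∈ P := by
    intro i
    by_cases hi : i ∈ S
    · rw [hL i]
      exact P.sub_mem
        (P.mul_mem_left _ (hpP (Ideal.mem_map_of_mem _ (hfg i hi).2)))
        (P.mul_mem_left _ (hpP (Ideal.mem_map_of_mem _ (hfg i hi).1)))
    · exact hsP (Finset.mem_coe.mpr (Finset.mem_image_of_mem L (Finset.mem_compl.mpr hi)))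
  have hlow : ((n + 1 : ℕ) : ℕ∞) ≤ P.height :=
    le_height_of_isRegularSeq hreg (n + 1) le_rfl P fun i _ => hLP i
  have hcard : s.card ≤ n - k := by
    refine Finset.card_image_le.trans ?_
    rw [Finset.card_compl, Fintype.card_fin, hS]
    omega
  have hle : ((k + 1 : ℕ) : ℕ∞) + ((n - k : ℕ) : ℕ∞) ≤
      p.asIdeal.height + ((n - k : ℕ) : ℕ∞) := by
    calc ((k + 1 : ℕ) : ℕ∞) + ((n - k : ℕ) : ℕ∞) = ((n + 1 : ℕ) : ℕ∞) := by
          rw [← Nat.cast_add]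
          congr 1
          omega
      _ ≤ p.asIdeal.height + s.card := hlow.trans hht
      _ ≤ p.asIdeal.height + ((n - k : ℕ) : ℕ∞) := by gcongr
  exact (ENat.add_le_add_iff_right (ENat.natCast_ne_top _)).mp hle
end
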